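/- Let ξ ∈ F_q((T⁻¹)) be irrational. Suppose (α_j)_{j≥1} is a sequence of separable quadratic elements over F_q(T) (α_j ≠ α_j′, ξ ≠ α_j) with H(α_j) strictly increasing to infinity, and suppose the limits γ₁ = lim_j (−log|ξ − α_j|)/log H(α_j) and γ₂ = lim_j (−log|α_j − α_j′|)/log H(α_j) exist. Then w₂*(ξ) ≥ γ₁ − 1 and w₂(ξ) ≥ γ₁ + γ₂ − 1. -/

import Mathlib

open Polynomial
open scoped Classical

noncomputable section

namespace CFq

variable (Fq : Type) [Field Fq] [Fintype Fq]

/-- The element `T` of `F_q((T⁻¹))`, realized as `X⁻¹` in the Laurent series field. -/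
def Tls : LaurentSeries Fq := HahnSeries.single (-1 : ℤ) (1 : Fq)

/-- The embedding of `F_q[T]` into `F_q((T⁻¹))`. -/
def toLS : Polynomial Fq →+* LaurentSeries Fq :=
  (Polynomial.aeval (Tls Fq)).toRingHom

/-- The absolute value `|ξ| = q^{-N}` where `ξ = Σ_{n ≥ N} a_n T^{-n}`, `a_N ≠ 0`. -/
def absQ (ξ : LaurentSeries Fq) : ℝ :=
  if ξ = 0 then 0 else (Fintype.card Fq : ℝ) ^ (-ξ.order)

/-- Absolute value of a polynomial in `T`:  `|f| = q^{deg f}`. -/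
def pabs (f : Polynomial Fq) : ℝ := absQ Fq (toLS Fq f)

/-- The height of a polynomial `P(X) ∈ (F_q[T])[X]`: the maximum of the absolute
values of its coefficients. -/
def Hpoly (P : Polynomial (Polynomial Fq)) : ℝ :=
  sSup {x : ℝ | ∃ i, x = pabs Fq (P.coeff i)}

/-- `ξ` has the (infinite) continued fraction expansion `[a₀; a₁, a₂, …]`, where all
partial quotients `aₙ`, `n ≥ 1`, have positive degree.  This is expressed via the
sequence of complete quotients (tails) `t n`, which satisfy `t n = a n + 1/(t (n+1))`
and `|t n| > 1` for `n ≥ 1`. -/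
def IsCF (ξ : LaurentSeries Fq) (a : ℕ → Polynomial Fq) : Prop :=
  (∀ n, 1 ≤ n → 1 ≤ (a n).natDegree) ∧
  ∃ t : ℕ → LaurentSeries Fq, t 0 = ξ ∧
    (∀ n, t n = toLS Fq (a n) + (t (n + 1))⁻¹) ∧
    (∀ n, 1 ≤ n → 1 < absQ Fq (t n))

/-- Denominators of the convergents: `q₀ = 1`, `q₁ = a₁`, `qₙ = aₙ q_{n-1} + q_{n-2}`. -/
def qden (a : ℕ → Polynomial Fq) : ℕ → Polynomial Fq
  | 0 => 1
  | 1 => a 1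
  | n + 2 => a (n + 2) * qden a (n + 1) + qden a n

/-- Evaluation of `P(X) ∈ (F_q[T])[X]` at a Laurent series. -/
def evalLS (P : Polynomial (Polynomial Fq)) (ξ : LaurentSeries Fq) : LaurentSeries Fq :=
  Polynomial.eval₂ (toLS Fq) ξ P

/-- The degree of an algebraic Laurent series over `F_q(T)`: the least degree of a
nonzero polynomial over `F_q[T]` annihilating it. -/
def degLS (ξ : LaurentSeries Fq) : ℕ :=
  sInf {d | ∃ P : Polynomial (Polynomial Fq), P ≠ 0 ∧ P.natDegree = d ∧ evalLS Fq P ξ = 0}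

/-- The height of an algebraic Laurent series: the least height of a nonzero annihilating
polynomial of minimal degree (this is the height of the primitive minimal polynomial). -/
def heightLS (ξ : LaurentSeries Fq) : ℝ :=
  sInf {x | ∃ P : Polynomial (Polynomial Fq),
    P ≠ 0 ∧ P.natDegree = degLS Fq ξ ∧ evalLS Fq P ξ = 0 ∧ x = Hpoly Fq P}

/-- The Diophantine exponent `w_n(ξ)`. -/
def wExp (n : ℕ) (ξ : LaurentSeries Fq) : EReal :=
  sSup ((fun w : ℝ => (w : EReal)) ''
    {w | {P : Polynomial (Polynomial Fq) | P.natDegree ≤ n ∧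
      0 < absQ Fq (evalLS Fq P ξ) ∧
      absQ Fq (evalLS Fq P ξ) ≤ Hpoly Fq P ^ (-w)}.Infinite})

variable (L : Type) [Field L] [Algebra (LaurentSeries Fq) L]

/-- The embedding of `F_q[T]` into a field extension `L` of `F_q((T⁻¹))`. -/
def embRing : Polynomial Fq →+* L :=
  (algebraMap (LaurentSeries Fq) L).comp (toLS Fq)

/-- Evaluation of `P(X) ∈ (F_q[T])[X]` at `α ∈ L`. -/
def evalA (P : Polynomial (Polynomial Fq)) (α : L) : L :=
  Polynomial.eval₂ (embRing Fq L) α P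

/-- The degree of an algebraic `α ∈ L` over `F_q(T)`. -/
def degA (α : L) : ℕ :=
  sInf {d | ∃ P : Polynomial (Polynomial Fq), P ≠ 0 ∧ P.natDegree = d ∧ evalA Fq L P α = 0}

/-- The height of an algebraic `α ∈ L`: the height of its primitive minimal polynomial
over `F_q[T]`. -/
def heightA (α : L) : ℝ :=
  sInf {x | ∃ P : Polynomial (Polynomial Fq),
    P ≠ 0 ∧ P.natDegree = degA Fq L α ∧ evalA Fq L P α = 0 ∧ x = Hpoly Fq P}

/-- `α ∈ L` is algebraic of degree at most `n` over `F_q(T)`. -/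
def IsAlgDeg (n : ℕ) (α : L) : Prop :=
  ∃ P : Polynomial (Polynomial Fq), P ≠ 0 ∧ P.natDegree ≤ n ∧ evalA Fq L P α = 0

/-- The Diophantine exponent `w_n^*(ξ)`, computed with respect to an extension `L` of
`F_q((T⁻¹))` (to be taken algebraically closed) endowed with an absolute value `v`
extending `absQ`. -/
def wstarExp (n : ℕ) (ξ : LaurentSeries Fq) (v : AbsoluteValue L ℝ) : EReal :=
  sSup ((fun w : ℝ => (w : EReal)) ''
    {w | {α : L | IsAlgDeg Fq L n α ∧
      0 < v (algebraMap (LaurentSeries Fq) L ξ - α) ∧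
      v (algebraMap (LaurentSeries Fq) L ξ - α) ≤ heightA Fq L α ^ (-w - 1)}.Infinite})

end CFq

end

namespace CFq

open Filter

section Series

variable (Fq : Type) [Field Fq]

lemma toLS_monomial (n : ℕ) (a : Fq) :
    toLS Fq (monomial n a) = HahnSeries.single (-(n : ℤ)) a := by
  change Polynomial.aeval (Tls Fq) (monomial n a) = _
  rw [Polynomial.aeval_monomial, Tls, HahnSeries.single_pow, LaurentSeries.algebraMap_apply]
  simp [HahnSeries.C_apply, HahnSeries.single_mul_single]

lemma coeff_toLS_neg (f : Polynomial Fq) (k : ℕ) : (toLS Fq f).coeff (-(k : ℤ)) = f.coeff k := by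
  induction f using Polynomial.induction_on' with
  | add p q hp hq => rw [map_add, HahnSeries.coeff_add, hp, hq, Polynomial.coeff_add]
  | monomial n a =>
    rw [toLS_monomial, HahnSeries.coeff_single, Polynomial.coeff_monomial]
    simp [eq_comm]

lemma coeff_toLS_pos (f : Polynomial Fq) {m : ℤ} (hm : 0 < m) : (toLS Fq f).coeff m = 0 := by
  induction f using Polynomial.induction_on' with
  | add p q hp hq => rw [map_add, HahnSeries.coeff_add, hp, hq, add_zero]
  | monomial n a =>
    rw [toLS_monomial, HahnSeries.coeff_single, if_neg (by lia)]

lemma toLS_smul (c : Fq) (f : Polynomial Fq) : toLS Fq (c • f) = c • toLS Fq f := by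
  rw [Polynomial.smul_eq_C_mul, map_mul, ← Polynomial.monomial_zero_left, toLS_monomial,
    ← HahnSeries.C_mul_eq_smul]
  simp [HahnSeries.C_apply]

variable [Fintype Fq]

lemma one_lt_card : (1 : ℝ) < Fintype.card Fq := by
  exact_mod_cast Fintype.one_lt_card

lemma absQ_le_of_coeff_eq_zero (x : LaurentSeries Fq) (N : ℤ) (h : ∀ m < N, x.coeff m = 0) :
    absQ Fq x ≤ (Fintype.card Fq : ℝ) ^ (-N) := by
  have hq := one_lt_card Fq
  unfold absQ
  split_ifs with hx
  · positivity
  · refine zpow_le_zpow_right₀ hq.le (neg_le_neg ?_)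
    by_contra! hlt
    exact hx (HahnSeries.coeff_order_eq_zero.mp (h _ hlt))

lemma pabs_zero : pabs Fq 0 = 0 := by simp [pabs, absQ]

lemma pabs_eq (f : Polynomial Fq) (hf : f ≠ 0) :
    pabs Fq f = (Fintype.card Fq : ℝ) ^ f.natDegree := by
  have hc : (toLS Fq f).coeff (-(f.natDegree : ℤ)) ≠ 0 := by
    rw [coeff_toLS_neg]
    simpa using hf
  have hne : toLS Fq f ≠ 0 := by
    intro h
    simp [h] at hc
  have ho : (toLS Fq f).order = -(f.natDegree : ℤ) := by
    refine le_antisymm (HahnSeries.order_le_of_coeff_ne_zero hc) ?_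
    by_contra! hlt
    apply hne
    apply HahnSeries.coeff_order_eq_zero.mp
    obtain ⟨k, hk⟩ : ∃ k : ℕ, (toLS Fq f).order = -(k : ℤ) :=
      ⟨(-(toLS Fq f).order).toNat, by lia⟩
    rw [hk, coeff_toLS_neg]
    exact Polynomial.coeff_eq_zero_of_natDegree_lt (by lia)
  rw [pabs, absQ, if_neg hne, ho, neg_neg, zpow_natCast]

lemma one_le_pabs (f : Polynomial Fq) (hf : f ≠ 0) : 1 ≤ pabs Fq f := by
  rw [pabs_eq Fq f hf]
  exact one_le_pow₀ (one_lt_card Fq).le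

lemma pabs_nonneg (f : Polynomial Fq) : 0 ≤ pabs Fq f := by
  by_cases hf : f = 0
  · rw [hf, pabs_zero]
  · exact zero_le_one.trans (one_le_pabs Fq f hf)

lemma toLS_injective : Function.Injective (toLS Fq) := by
  refine (injective_iff_map_eq_zero _).mpr fun f hf => ?_
  by_contra hne
  have h := one_le_pabs Fq f hne
  rw [pabs, hf, absQ, if_pos rfl] at h
  linarith

lemma finite_range_coeff (P : Polynomial (Polynomial Fq)) :
    {x : ℝ | ∃ i, x = pabs Fq (P.coeff i)}.Finite := by
  refine ((Set.finite_Iic P.natDegree).image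
    (fun i => pabs Fq (P.coeff i)) |>.insert 0).subset ?_
  rintro _ ⟨i, rfl⟩
  by_cases hi : i ≤ P.natDegree
  · exact Or.inr ⟨i, hi, rfl⟩
  · left
    rw [Polynomial.coeff_eq_zero_of_natDegree_lt (not_le.mp hi), pabs_zero]

lemma pabs_coeff_le_Hpoly (P : Polynomial (Polynomial Fq)) (i : ℕ) :
    pabs Fq (P.coeff i) ≤ Hpoly Fq P :=
  le_csSup (finite_range_coeff Fq P).bddAbove ⟨i, rfl⟩

lemma Hpoly_eq_pow (P : Polynomial (Polynomial Fq)) (hP : P ≠ 0) :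
    ∃ n : ℕ, Hpoly Fq P = (Fintype.card Fq : ℝ) ^ n := by
  obtain ⟨i, hi⟩ : ∃ i, Hpoly Fq P = pabs Fq (P.coeff i) :=
    Set.Nonempty.csSup_mem (s := {x : ℝ | ∃ i, x = pabs Fq (P.coeff i)}) ⟨_, 0, rfl⟩ (finite_range_coeff Fq P)
  have hne : P.coeff i ≠ 0 := by
    intro h0
    have h := (one_le_pabs Fq _ (leadingCoeff_ne_zero.mpr hP)).trans
      (pabs_coeff_le_Hpoly Fq P P.natDegree)
    rw [hi, h0, pabs_zero] at h
    linarith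
  exact ⟨_, hi.trans (pabs_eq Fq _ hne)⟩

/-- Dirichlet's theorem in `F_q((T⁻¹))`. -/
lemma exists_approx (ξ : LaurentSeries Fq) (n : ℕ) :
    ∃ a b : Polynomial Fq, b ≠ 0 ∧ b.natDegree ≤ n ∧
      absQ Fq (toLS Fq b * ξ - toLS Fq a) ≤ (Fintype.card Fq : ℝ) ^ (-(n + 1 : ℤ)) := by
  let φ : Polynomial.degreeLT Fq (n + 1) →ₗ[Fq] (Fin n → Fq) :=
    { toFun := fun b i => (toLS Fq (b : Polynomial Fq) * ξ).coeff ((i : ℤ) + 1)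
      map_add' := fun b c => by
        ext i
        simp [add_mul]
      map_smul' := fun r b => by
        ext i
        change (toLS Fq (r • (b : Polynomial Fq)) * ξ).coeff _ = r * _
        rw [toLS_smul, ← HahnSeries.C_mul_eq_smul, mul_assoc, HahnSeries.C_mul_eq_smul,
          HahnSeries.coeff_smul, smul_eq_mul] }
  have hfin : Module.finrank Fq (Polynomial.degreeLT Fq (n + 1)) = n + 1 := by
    rw [(Polynomial.degreeLTEquiv Fq (n + 1)).finrank_eq, Module.finrank_fin_fun]
  have : Module.Finite Fq (Polynomial.degreeLT Fq (n + 1)) :=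
    Module.Finite.equiv (Polynomial.degreeLTEquiv Fq (n + 1)).symm
  have hker : LinearMap.ker φ ≠ ⊥ :=
    LinearMap.ker_ne_bot_of_finrank_lt (by rw [hfin, Module.finrank_fin_fun]; lia)
  obtain ⟨⟨b, hbdeg⟩, hbker, hb0⟩ := Submodule.exists_mem_ne_zero_of_ne_bot hker
  have hb : b ≠ 0 := fun h => hb0 (Subtype.ext h)
  set y := toLS Fq b * ξ with hy
  have hφ : ∀ i : Fin n, y.coeff ((i : ℤ) + 1) = 0 := fun i => congrFun hbker i
  set M := (-y.order).toNat with hM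
  let a : Polynomial Fq := ∑ k ∈ Finset.range (M + 1), monomial k (y.coeff (-(k : ℤ)))
  have ha : ∀ k : ℕ, a.coeff k = y.coeff (-(k : ℤ)) := by
    intro k
    simp only [a, Polynomial.finsetSum_coeff, Polynomial.coeff_monomial]
    rw [Finset.sum_ite_eq']
    split_ifs with hk
    · rfl
    · rw [Finset.mem_range] at hk
      exact (HahnSeries.coeff_eq_zero_of_lt_order (by lia)).symm
  refine ⟨a, b, hb, ?_, absQ_le_of_coeff_eq_zero Fq _ _ fun m hm => ?_⟩
  · have := Polynomial.mem_degreeLT.mp hbdeg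
    rw [← Polynomial.natDegree_lt_iff_degree_lt hb] at this
    lia
  · rw [HahnSeries.coeff_sub]
    rcases le_or_gt m 0 with h | h
    · obtain ⟨k, rfl⟩ : ∃ k : ℕ, m = -(k : ℤ) := ⟨(-m).toNat, by lia⟩
      rw [coeff_toLS_neg, ha, sub_self]
    · rw [coeff_toLS_pos Fq a h, sub_zero]
      have := hφ ⟨(m - 1).toNat, by lia⟩
      rwa [show (((⟨(m - 1).toNat, by lia⟩ : Fin n) : ℕ) : ℤ) + 1 = m by simp; lia] at this

end Series

lemma coe_le_of_forall_lt {a c : ℝ} {s : EReal} (hac : a < c)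
    (h : ∀ w : ℝ, a < w → w < c → (w : EReal) ≤ s) : (c : EReal) ≤ s := by
  by_contra! hlt
  obtain ⟨z, hsz, hzc⟩ := EReal.lt_iff_exists_real_btwn.mp hlt
  have hzc' : z < c := EReal.coe_lt_coe_iff.mp hzc
  have h1 := h (max z ((a + c) / 2)) (lt_max_of_lt_right (by linarith))
    (max_lt hzc' (by linarith))
  exact (hsz.trans_le (EReal.coe_le_coe_iff.mpr (le_max_left _ _))).not_ge h1

section Exponents

variable (Fq : Type) [Field Fq]

section Evaluation

variable (L : Type) [Field L] [Algebra (LaurentSeries Fq) L]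

lemma algebraMap_evalLS (P : Polynomial (Polynomial Fq)) (ξ : LaurentSeries Fq) :
    algebraMap (LaurentSeries Fq) L (evalLS Fq P ξ) =
      evalA Fq L P (algebraMap (LaurentSeries Fq) L ξ) :=
  Polynomial.hom_eval₂ _ _ _ _

lemma degA_le {α : L} {P : Polynomial (Polynomial Fq)} (hP0 : P ≠ 0)
    (hP : evalA Fq L P α = 0) : degA Fq L α ≤ P.natDegree :=
  Nat.sInf_le ⟨P, hP0, rfl, hP⟩

lemma evalA_of_natDegree_eq_two {P : Polynomial (Polynomial Fq)} (hd : P.natDegree = 2) (x : L) :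
    evalA Fq L P x = embRing Fq L (P.coeff 2) * x ^ 2 + embRing Fq L (P.coeff 1) * x +
      embRing Fq L (P.coeff 0) := by
  rw [evalA, Polynomial.eval₂_eq_sum_range, hd]
  simp [Finset.sum_range_succ]
  ring

variable {Fq L} {P : Polynomial (Polynomial Fq)} {α β : L}

lemma vieta_sum (hd : P.natDegree = 2) (hα : evalA Fq L P α = 0) (hβ : evalA Fq L P β = 0)
    (hne : α ≠ β) : embRing Fq L (P.coeff 1) = -embRing Fq L (P.coeff 2) * (α + β) := by
  rw [evalA_of_natDegree_eq_two Fq L hd] at hα hβ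
  refine mul_left_cancel₀ (sub_ne_zero.mpr hne) ?_
  linear_combination hα - hβ

lemma evalA_eq_mul (hd : P.natDegree = 2) (hα : evalA Fq L P α = 0) (hβ : evalA Fq L P β = 0)
    (hne : α ≠ β) (x : L) :
    evalA Fq L P x = embRing Fq L (P.coeff 2) * (x - α) * (x - β) := by
  have h := vieta_sum hd hα hβ hne
  rw [evalA_of_natDegree_eq_two Fq L hd] at hα ⊢
  linear_combination hα + (x - α) * h

end Evaluation

variable [Fintype Fq]

lemma one_le_Hpoly (P : Polynomial (Polynomial Fq)) (hP : P ≠ 0) : 1 ≤ Hpoly Fq P := by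
  obtain ⟨n, hn⟩ := Hpoly_eq_pow Fq P hP
  rw [hn]
  exact one_le_pow₀ (one_lt_card Fq).le

lemma le_wExp {n : ℕ} {ξ : LaurentSeries Fq} {w : ℝ}
    (h : {P : Polynomial (Polynomial Fq) | P.natDegree ≤ n ∧
      0 < absQ Fq (evalLS Fq P ξ) ∧
      absQ Fq (evalLS Fq P ξ) ≤ Hpoly Fq P ^ (-w)}.Infinite) :
    (w : EReal) ≤ wExp Fq n ξ :=
  le_sSup ⟨w, h, rfl⟩

variable (L : Type) [Field L] [Algebra (LaurentSeries Fq) L] (v : AbsoluteValue L ℝ)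

lemma embRing_injective : Function.Injective (embRing Fq L) :=
  (algebraMap (LaurentSeries Fq) L).injective.comp (toLS_injective Fq)

/-- For irrational `ξ` there are infinitely many linear polynomials with exponent near `1`. -/
lemma one_le_wExp
    (hv : ∀ x : LaurentSeries Fq, v (algebraMap (LaurentSeries Fq) L x) = absQ Fq x)
    (ξ : LaurentSeries Fq)
    (hirr : ¬ ∃ P : Polynomial (Polynomial Fq), P ≠ 0 ∧ P.natDegree ≤ 1 ∧ evalLS Fq P ξ = 0)
    {n : ℕ} (hn : 1 ≤ n) : ((1 : ℝ) : EReal) ≤ wExp Fq n ξ := by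
  have hq := one_lt_card Fq
  have hq0 : (0 : ℝ) < Fintype.card Fq := zero_lt_one.trans hq
  set q : ℝ := (Fintype.card Fq : ℝ)
  refine coe_le_of_forall_lt zero_lt_one fun w hw0 hw1 => le_wExp Fq fun hfin => ?_
  set S := {P : Polynomial (Polynomial Fq) | P.natDegree ≤ n ∧
      0 < absQ Fq (evalLS Fq P ξ) ∧
      absQ Fq (evalLS Fq P ξ) ≤ Hpoly Fq P ^ (-w)}
  obtain ⟨ε, hε, hεS⟩ : ∃ ε : ℝ, 0 < ε ∧ ∀ P ∈ S, ε ≤ absQ Fq (evalLS Fq P ξ) := by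
    rcases S.eq_empty_or_nonempty with he | hne
    · exact ⟨1, one_pos, by simp [he]⟩
    · obtain ⟨P, hPS, hP⟩ := Set.exists_min_image S (fun P => absQ Fq (evalLS Fq P ξ)) hfin hne
      exact ⟨_, hPS.2.1, hP⟩
  have hpow : Tendsto (fun m : ℕ => q ^ m) atTop atTop := tendsto_pow_atTop_atTop_of_one_lt hq
  set K : ℝ := absQ Fq ξ + 1 with hK
  have habs0 : 0 ≤ absQ Fq ξ := by rw [← hv]; exact v.nonneg _
  obtain ⟨m, hm1, hm2⟩ := ((hpow.eventually_gt_atTop ε⁻¹).and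
    (((tendsto_rpow_atTop (sub_pos.mpr hw1)).comp hpow).eventually_ge_atTop K)).exists
  simp only [Function.comp_apply] at hm2
  have hQ : 0 < q ^ m := pow_pos hq0 m
  obtain ⟨a, b, hb, hbm, hab⟩ := exists_approx Fq ξ m
  have hab' : absQ Fq (toLS Fq b * ξ - toLS Fq a) ≤ (q ^ m)⁻¹ := by
    refine hab.trans ?_
    rw [← zpow_natCast, ← zpow_neg]
    exact zpow_le_zpow_right₀ hq.le (by lia)
  set P : Polynomial (Polynomial Fq) := C b * X + C (-a) with hP
  have hPdeg : P.natDegree ≤ 1 := Polynomial.natDegree_linear_le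
  have hP0 : P ≠ 0 := fun h => hb (by simpa [hP] using congrArg (fun R => R.coeff 1) h)
  have heval : evalLS Fq P ξ = toLS Fq b * ξ - toLS Fq a := by
    simp [evalLS, hP, sub_eq_add_neg]
  have hpos : 0 < absQ Fq (evalLS Fq P ξ) := by
    rw [← hv]
    refine v.pos fun h => hirr ⟨P, hP0, hPdeg, ?_⟩
    exact (map_eq_zero _).mp h
  have hbabs : pabs Fq b ≤ q ^ m := by
    rw [pabs_eq Fq b hb]
    exact pow_le_pow_right₀ hq.le hbm
  have hQ1 : 1 ≤ q ^ m := one_le_pow₀ hq.le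
  have haabs : pabs Fq a ≤ absQ Fq ξ * q ^ m + 1 := by
    have h1 : pabs Fq a ≤ pabs Fq b * absQ Fq ξ + absQ Fq (toLS Fq b * ξ - toLS Fq a) := by
      have h := v.add_le (algebraMap (LaurentSeries Fq) L (toLS Fq b * ξ))
        (-algebraMap (LaurentSeries Fq) L (toLS Fq b * ξ - toLS Fq a))
      rw [v.map_neg, ← map_neg, ← map_add, neg_sub, add_sub_cancel, map_mul, map_mul] at h
      simpa only [pabs, hv] using h
    have h2 : (q ^ m)⁻¹ ≤ 1 := inv_le_one_of_one_le₀ hQ1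
    nlinarith
  have hH : Hpoly Fq P ≤ K * q ^ m := by
    refine csSup_le ⟨_, 0, rfl⟩ ?_
    rintro _ ⟨i, rfl⟩
    match i with
    | 0 =>
      have h0 : pabs Fq (P.coeff 0) = pabs Fq a := by
        simp [hP, pabs, ← hv]
      rw [h0]
      nlinarith
    | 1 =>
      have h1 : P.coeff 1 = b := by simp [hP]
      rw [h1]
      nlinarith
    | k + 2 =>
      rw [Polynomial.coeff_eq_zero_of_natDegree_lt (by lia), pabs_zero]
      positivity
  have hH1 := one_le_Hpoly Fq P hP0
  have hmem : P ∈ S := by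
    refine ⟨hPdeg.trans hn, hpos, ?_⟩
    rw [heval]
    refine hab'.trans ?_
    rw [Real.rpow_neg (by linarith)]
    refine inv_anti₀ (by positivity) ?_
    have hK1 : 1 ≤ K := by linarith
    calc Hpoly Fq P ^ w ≤ (K * q ^ m) ^ w := Real.rpow_le_rpow (by linarith) hH hw0.le
      _ = K ^ w * (q ^ m) ^ w := Real.mul_rpow (by linarith) hQ.le
      _ ≤ K ^ (1 : ℝ) * (q ^ m) ^ w := by gcongr
      _ ≤ (q ^ m) ^ (1 - w) * (q ^ m) ^ w := by rw [Real.rpow_one]; gcongr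
      _ = q ^ m := by rw [← Real.rpow_add hQ, sub_add_cancel, Real.rpow_one]
  have := hεS P hmem
  rw [heval] at this
  have h3 : (q ^ m)⁻¹ < ε := inv_lt_of_inv_lt₀ hε hm1
  linarith

/-- The height of an algebraic element is attained. -/
lemma exists_Hpoly_eq_heightA {α : L} (h : ∃ P : Polynomial (Polynomial Fq),
      P ≠ 0 ∧ evalA Fq L P α = 0) :
    ∃ P : Polynomial (Polynomial Fq), P ≠ 0 ∧ P.natDegree = degA Fq L α ∧
      evalA Fq L P α = 0 ∧ Hpoly Fq P = heightA Fq L α := by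
  obtain ⟨Q, hQ0, hQd, hQ⟩ : degA Fq L α ∈ {d | ∃ P : Polynomial (Polynomial Fq),
      P ≠ 0 ∧ P.natDegree = d ∧ evalA Fq L P α = 0} := by
    obtain ⟨P, hP, hP'⟩ := h
    exact Nat.sInf_mem ⟨_, P, hP, rfl, hP'⟩
  have hex : ∃ n : ℕ, ∃ P : Polynomial (Polynomial Fq), P ≠ 0 ∧ P.natDegree = degA Fq L α ∧
      evalA Fq L P α = 0 ∧ Hpoly Fq P = (Fintype.card Fq : ℝ) ^ n := by
    obtain ⟨n, hn⟩ := Hpoly_eq_pow Fq Q hQ0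
    exact ⟨n, Q, hQ0, hQd, hQ, hn⟩
  obtain ⟨P, hP0, hPd, hP, hPH⟩ := Nat.find_spec hex
  refine ⟨P, hP0, hPd, hP, Eq.symm (IsLeast.csInf_eq ⟨⟨P, hP0, hPd, hP, rfl⟩, ?_⟩)⟩
  rintro _ ⟨R, hR0, hRd, hR, rfl⟩
  obtain ⟨n, hn⟩ := Hpoly_eq_pow Fq R hR0
  rw [hPH, hn]
  exact pow_le_pow_right₀ (one_lt_card Fq).le (Nat.find_min' hex ⟨R, hR0, hRd, hR, hn⟩)

/-- Two annihilating polynomials of minimal degree have the same roots. -/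
lemma evalA_eq_zero_of_natDegree_eq_degA {α β : L} {P Q : Polynomial (Polynomial Fq)}
    (hQ0 : Q ≠ 0) (hPd : P.natDegree = degA Fq L α) (hQd : Q.natDegree = degA Fq L α)
    (hP : evalA Fq L P α = 0) (hQ : evalA Fq L Q α = 0) (hQβ : evalA Fq L Q β = 0) :
    evalA Fq L P β = 0 := by
  set R := C Q.leadingCoeff * P - C P.leadingCoeff * Q with hR
  have heval : ∀ x, evalA Fq L R x = embRing Fq L Q.leadingCoeff * evalA Fq L P x -
      embRing Fq L P.leadingCoeff * evalA Fq L Q x := by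
    intro x
    simp [evalA, hR]
  have hR0 : R = 0 := by
    by_contra hne
    have h1 := degA_le Fq L hne (α := α) (by simp [heval, hP, hQ])
    have h2 : R.natDegree ≤ degA Fq L α := by
      refine (Polynomial.natDegree_sub_le _ _).trans (max_le ?_ ?_)
      · exact (Polynomial.natDegree_C_mul_le _ _).trans hPd.le
      · exact (Polynomial.natDegree_C_mul_le _ _).trans hQd.le
    have h3 : R.coeff (degA Fq L α) = 0 := by
      simp only [hR, Polynomial.coeff_sub, Polynomial.coeff_C_mul, Polynomial.leadingCoeff,
        hPd, hQd]
      ring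
    rw [← le_antisymm h2 h1] at h3
    exact hne (Polynomial.leadingCoeff_eq_zero.mp h3)
  have h := heval β
  rw [hR0, hQβ, mul_zero, sub_zero] at h
  have h0 : evalA Fq L 0 β = 0 := by simp [evalA]
  rw [h0, eq_comm, mul_eq_zero] at h
  refine h.resolve_left fun h' => hQ0 ?_
  exact Polynomial.leadingCoeff_eq_zero.mp ((map_eq_zero_iff _ (embRing_injective Fq L)).mp h')

section Quadratic

variable {Fq L v} {P : Polynomial (Polynomial Fq)} {α β : L}

lemma v_embRing
    (hv : ∀ x : LaurentSeries Fq, v (algebraMap (LaurentSeries Fq) L x) = absQ Fq x)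
    (f : Polynomial Fq) : v (embRing Fq L f) = pabs Fq f := hv _

/-- Liouville's lower bound for the distance of conjugate quadratic elements. -/
lemma one_le_Hpoly_mul_dist
    (hv : ∀ x : LaurentSeries Fq, v (algebraMap (LaurentSeries Fq) L x) = absQ Fq x)
    (hd : P.natDegree = 2) (hα : evalA Fq L P α = 0) (hβ : evalA Fq L P β = 0)
    (hne : α ≠ β) : 1 ≤ Hpoly Fq P * v (α - β) := by
  have hP0 : P.coeff 2 ≠ 0 := by
    rw [← hd]
    exact Polynomial.leadingCoeff_ne_zero.mpr (by rintro rfl; simp at hd)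
  have hdisc : (embRing Fq L (P.coeff 2) * (α - β)) ^ 2 =
      embRing Fq L (P.coeff 1 ^ 2 - 4 * P.coeff 2 * P.coeff 0) := by
    have h := vieta_sum hd hα hβ hne
    rw [evalA_of_natDegree_eq_two Fq L hd] at hα
    simp only [map_sub, map_mul, map_pow, map_ofNat]
    rw [h] at hα ⊢
    linear_combination (4 * embRing Fq L (P.coeff 2)) * hα
  have hD : P.coeff 1 ^ 2 - 4 * P.coeff 2 * P.coeff 0 ≠ 0 := by
    intro h0
    rw [h0, map_zero, sq_eq_zero_iff, mul_eq_zero, sub_eq_zero,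
      map_eq_zero_iff _ (embRing_injective Fq L)] at hdisc
    exact hdisc.elim hP0 hne
  have h1 : 1 ≤ (v (embRing Fq L (P.coeff 2)) * v (α - β)) ^ 2 := by
    rw [← map_mul, ← map_pow, hdisc, v_embRing hv]
    exact one_le_pabs Fq _ hD
  have h2 : 1 ≤ v (embRing Fq L (P.coeff 2)) * v (α - β) :=
    (one_le_sq_iff₀ (mul_nonneg (v.nonneg _) (v.nonneg _))).mp h1
  rw [v_embRing hv] at h2
  exact h2.trans (mul_le_mul_of_nonneg_right (pabs_coeff_le_Hpoly Fq P 2) (v.nonneg _))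

end Quadratic

end Exponents

lemma infinite_of_eventually_mem {X : Type*} {f : ℕ → X} (hf : Function.Injective f) {S : Set X}
    (h : ∀ᶠ j in atTop, f j ∈ S) : S.Infinite := by
  obtain ⟨N, hN⟩ := eventually_atTop.mp h
  exact ((Set.Ici_infinite N).image hf.injOn).mono (Set.image_subset_iff.mpr hN)

lemma eventually_le_rpow_of_tendsto {x h : ℕ → ℝ} {γ c : ℝ} (hx : ∀ j, 0 < x j)
    (hh : Tendsto h atTop atTop)
    (hlim : Tendsto (fun j => -Real.log (x j) / Real.log (h j)) atTop (nhds γ)) (hc : c < γ) :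
    ∀ᶠ j in atTop, x j ≤ h j ^ (-c) := by
  filter_upwards [hlim.eventually (lt_mem_nhds hc), hh.eventually_gt_atTop 1] with j hj hj1
  have hlog := Real.log_pos hj1
  rw [lt_div_iff₀ hlog] at hj
  rw [← Real.log_le_log_iff (hx j) (by positivity), Real.log_rpow (by positivity)]
  linarith

end CFq

/-- lower bounds for `w₂` and `w₂*` via a sequence of separable quadratic
approximations. -/
theorem stmt12 (Fq : Type) [Field Fq] [Fintype Fq]
    (L : Type) [Field L] [Algebra (LaurentSeries Fq) L] [IsAlgClosed L]
    (v : AbsoluteValue L ℝ)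
    (hv : ∀ x : LaurentSeries Fq, v (algebraMap (LaurentSeries Fq) L x) = CFq.absQ Fq x)
    (ξ : LaurentSeries Fq)
    (hirr : ¬ ∃ P : Polynomial (Polynomial Fq),
      P ≠ 0 ∧ P.natDegree ≤ 1 ∧ CFq.evalLS Fq P ξ = 0)
    (α α' : ℕ → L)
    (hquad : ∀ j, CFq.degA Fq L (α j) = 2)
    (hconj : ∀ j, ∃ P : Polynomial (Polynomial Fq), P ≠ 0 ∧ P.natDegree = 2 ∧
      CFq.evalA Fq L P (α j) = 0 ∧ CFq.evalA Fq L P (α' j) = 0)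
    (hsep : ∀ j, α j ≠ α' j)
    (hneq : ∀ j, algebraMap (LaurentSeries Fq) L ξ ≠ α j)
    (hmono : StrictMono fun j => CFq.heightA Fq L (α j))
    (htop : Filter.Tendsto (fun j => CFq.heightA Fq L (α j)) Filter.atTop Filter.atTop)
    (γ₁ γ₂ : ℝ)
    (hlim1 : Filter.Tendsto
      (fun j => (-Real.log (v (algebraMap (LaurentSeries Fq) L ξ - α j))) /
        Real.log (CFq.heightA Fq L (α j))) Filter.atTop (nhds γ₁))
    (hlim2 : Filter.Tendsto
      (fun j => (-Real.log (v (α j - α' j))) /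
        Real.log (CFq.heightA Fq L (α j))) Filter.atTop (nhds γ₂)) :
    ((γ₁- 1 : ℝ) : EReal) ≤ CFq.wstarExp Fq L 2 ξ v ∧
      ((γ₁ + γ₂ - 1 : ℝ) : EReal) ≤ CFq.wExp Fq 2 ξ := by
  set h : ℕ → ℝ := fun j => CFq.heightA Fq L (α j)
  choose Q hQ0 hQd hQα hQα' using hconj
  choose P hP0 hPd hPα hPH using fun j =>
    CFq.exists_Hpoly_eq_heightA Fq L (α := α j) ⟨Q j, hQ0 j, hQα j⟩
  have hPα' : ∀ j, CFq.evalA Fq L (P j) (α' j) = 0 := fun j =>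
    CFq.evalA_eq_zero_of_natDegree_eq_degA Fq L (hQ0 j) (hPd j) ((hQd j).trans (hquad j).symm)
      (hPα j) (hQα j) (hQα' j)
  have hPd2 : ∀ j, (P j).natDegree = 2 := fun j => (hPd j).trans (hquad j)
  have hx : ∀ j, 0 < v (algebraMap (LaurentSeries Fq) L ξ - α j) :=
    fun j => v.pos (sub_ne_zero.mpr (hneq j))
  have hy : ∀ j, 0 < v (α j - α' j) := fun j => v.pos (sub_ne_zero.mpr (hsep j))
  constructor
  · refine CFq.coe_le_of_forall_lt (sub_one_lt (γ₁ - 1)) fun w _ hw => le_sSup ⟨w, ?_, rfl⟩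
    refine CFq.infinite_of_eventually_mem (f := α) (fun i j hij => hmono.injective ?_) ?_
    · exact congrArg (CFq.heightA Fq L) hij
    · filter_upwards [CFq.eventually_le_rpow_of_tendsto hx htop hlim1
        (c := w + 1) (by linarith)] with j hj
      refine ⟨⟨P j, hP0 j, (hPd2 j).le, hPα j⟩, hx j, ?_⟩
      rwa [neg_add'] at hj
  have hγ₂ : γ₂ ≤ 1 := by
    refine le_of_tendsto hlim2 ?_
    filter_upwards [htop.eventually_gt_atTop 1] with j hj
    have h1 := CFq.one_le_Hpoly_mul_dist hv (hPd2 j) (hPα j) (hPα' j) (hsep j)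
    have h2 := Real.log_nonneg h1
    rw [hPH j, Real.log_mul (by linarith) (hy j).ne'] at h2
    rw [div_le_one (Real.log_pos hj)]
    linarith
  rcases le_or_gt γ₁ 1 with hγ₁ | hγ₁
  · exact (EReal.coe_le_coe_iff.mpr (by linarith)).trans
      (CFq.one_le_wExp Fq L v hv ξ hirr one_le_two)
  refine CFq.coe_le_of_forall_lt (sub_one_lt _) fun w _ hw => CFq.le_wExp Fq ?_
  refine CFq.infinite_of_eventually_mem (f := P) (fun i j hij => hmono.injective ?_) ?_
  · exact (hPH i).symm.trans ((congrArg (CFq.Hpoly Fq) hij).trans (hPH j))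
  set ε := (γ₁ + γ₂ - 1 - w) / 3 with hε
  have hε0 : 0 < ε := by linarith
  filter_upwards [CFq.eventually_le_rpow_of_tendsto hx htop hlim1 (sub_lt_self γ₁ hε0),
    CFq.eventually_le_rpow_of_tendsto hy htop hlim2 (sub_lt_self γ₂ hε0),
    ((tendsto_rpow_atTop hε0).comp htop).eventually_ge_atTop 2,
    hlim2.eventually_lt hlim1 (hγ₂.trans_lt hγ₁), htop.eventually_gt_atTop 1]
    with j hj1 hj2 hj3 hj4 hj5
  have hlt : v (algebraMap (LaurentSeries Fq) L ξ - α j) < v (α j - α' j) := by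
    rw [div_lt_div_iff_of_pos_right (Real.log_pos hj5), neg_lt_neg_iff] at hj4
    exact (Real.log_lt_log_iff (hx j) (hy j)).mp hj4
  have hξα' : algebraMap (LaurentSeries Fq) L ξ ≠ α' j := by
    intro heq
    rw [heq, v.map_sub] at hlt
    exact lt_irrefl _ hlt
  have habs : CFq.absQ Fq (CFq.evalLS Fq (P j) ξ) =
      CFq.pabs Fq ((P j).coeff 2) * v (algebraMap (LaurentSeries Fq) L ξ - α j) *
        v (algebraMap (LaurentSeries Fq) L ξ - α' j) := by
    rw [← hv, CFq.algebraMap_evalLS,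
      CFq.evalA_eq_mul (hPd2 j) (hPα j) (hPα' j) (hsep j), map_mul, map_mul, CFq.v_embRing hv]
  have hlead : (P j).coeff 2 ≠ 0 := by
    rw [← hPd2 j]
    exact Polynomial.leadingCoeff_ne_zero.mpr (hP0 j)
  have htri : v (algebraMap (LaurentSeries Fq) L ξ - α' j) ≤ 2 * v (α j - α' j) := by
    have := v.sub_le (algebraMap (LaurentSeries Fq) L ξ) (α j) (α' j)
    linarith
  have hH0 : 0 < h j := zero_lt_one.trans hj5
  have hcoeff : CFq.pabs Fq ((P j).coeff 2) ≤ h j :=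
    (CFq.pabs_coeff_le_Hpoly Fq (P j) 2).trans_eq (hPH j)
  refine ⟨(hPd2 j).le, ?_, ?_⟩
  · rw [habs]
    have := zero_lt_one.trans_le (CFq.one_le_pabs Fq _ hlead)
    have := v.pos (sub_ne_zero.mpr hξα')
    have := hx j
    positivity
  · rw [habs, hPH j]
    calc CFq.pabs Fq ((P j).coeff 2) * v (algebraMap (LaurentSeries Fq) L ξ - α j) *
          v (algebraMap (LaurentSeries Fq) L ξ - α' j)
        ≤ h j * h j ^ (-(γ₁ - ε)) * (h j ^ ε * h j ^ (-(γ₂ - ε))) := by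
          have h2 : v (algebraMap (LaurentSeries Fq) L ξ - α' j) ≤
              h j ^ ε * h j ^ (-(γ₂ - ε)) :=
            htri.trans (mul_le_mul hj3 hj2 (v.nonneg _) (by positivity))
          exact mul_le_mul (mul_le_mul hcoeff hj1 (v.nonneg _) hH0.le) h2 (v.nonneg _)
            (by positivity)
      _ = h j ^ (-w) := by
          nth_rewrite 1 [← Real.rpow_one (h j)]
          rw [← Real.rpow_add hH0, ← Real.rpow_add hH0, ← Real.rpow_add hH0]
          congr 1
          rw [hε]
          ring
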